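/- The sequence of Stirling numbers of the second kind is asymptotically normal: for each n let X_n be the ℤ-valued random variable with P(X_n = k) = S(n,k)/B_n, where S(n,k) is the number of partitions of an n-element set into k non-empty blocks and B_n = Σ_j S(n,j) is the n-th Bell number, and let μ_n and σ_n be the mean and standard deviation of X_n. Then for every real number x, P((X_n − μ_n)/σ_n ≤ x) → P(Z ≤ x) as n → ∞, where Z is a standard normal random variable. -/

import Mathlib

/-- Total mass of a sequence indexed by `ℤ`. -/
noncomputable def seqTotal (a : ℤ → ℝ) : ℝ := ∑ᶠ k, a k

/-- The probability mass function obtained by normalizing the sequence `a`. -/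
noncomputable def seqPMF (a : ℤ → ℝ) (k : ℤ) : ℝ := a k / seqTotal a

/-- The mean of the random variable `X` with `P(X = k) = a k / Σ_j a j`. -/
noncomputable def seqMean (a : ℤ → ℝ) : ℝ := ∑ᶠ k : ℤ, (k : ℝ) * seqPMF a k

/-- The standard deviation of the random variable `X` with `P(X = k) = a k / Σ_j a j`. -/
noncomputable def seqStdDev (a : ℤ → ℝ) : ℝ :=
  Real.sqrt (∑ᶠ k : ℤ, ((k : ℝ) - seqMean a) ^ 2 * seqPMF a k)

/-- `P((X - μ)/σ ≤ x)` for the random variable `X` with `P(X = k) = a k / Σ_j a j`. -/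
noncomputable def seqNormalizedCDF (a : ℤ → ℝ) (x : ℝ) : ℝ :=
  ∑ᶠ k ∈ {k : ℤ | ((k : ℝ) - seqMean a) / seqStdDev a ≤ x}, seqPMF a k

/-- The cumulative distribution function of the standard normal distribution. -/
noncomputable def stdNormalCDF (x : ℝ) : ℝ :=
  ∫ t in Set.Iio x, Real.exp (-(t ^ 2) / 2) / Real.sqrt (2 * Real.pi)

/-- A family of non-negative sequences `(a n k)_{k ∈ ℤ}` is asymptotically normal if the
normalized random variable `(X_n - μ_n)/σ_n` converges in distribution to a standard normal. -/
def AsymptoticallyNormal (a : ℕ → ℤ → ℝ) : Prop :=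
  ∀ x : ℝ, Filter.Tendsto (fun n => seqNormalizedCDF (a n) x)
    Filter.atTop (nhds (stdNormalCDF x))

/-- `stirlingS2' n k` is the Stirling number of the second kind: the number of partitions of
an `n`-element set into `k` non-empty blocks. -/
noncomputable def stirlingS2' (n k : ℕ) : ℕ :=
  Nat.card {P : Finset (Finset (Fin n)) // P.card = k ∧ (∀ p ∈ P, p.Nonempty) ∧
    ∀ v : Fin n, ∃! p, p ∈ P ∧ v ∈ p}

/-- The blocks of the kernel of `f`, that is, its non-empty fibres. -/
def kernelBlocks {α β : Type*} [Fintype α] [DecidableEq α] [DecidableEq β] (f : α → β) :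
    Finset (Finset α) :=
  Finset.univ.image fun v => Finset.univ.filter fun w => f w = f v

/-- `P` is a partition of `Fin n` into non-empty blocks. -/
def IsBlockPartition {n : ℕ} (P : Finset (Finset (Fin n))) : Prop :=
  (∀ p ∈ P, p.Nonempty) ∧ ∀ v : Fin n, ∃! p, p ∈ P ∧ v ∈ p

theorem isBlockPartition_kernelBlocks {n : ℕ} {β : Type*} [DecidableEq β] (f : Fin n → β) :
    IsBlockPartition (kernelBlocks f) := by
  constructor
  · intro p hp
    obtain ⟨v, -, rfl⟩ := Finset.mem_image.1 hp
    exact ⟨v, by simp⟩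
  · intro v
    refine ⟨Finset.univ.filter fun w => f w = f v,
      ⟨Finset.mem_image_of_mem _ (Finset.mem_univ v), by simp⟩, ?_⟩
    rintro q ⟨hq, hv⟩
    obtain ⟨u, -, rfl⟩ := Finset.mem_image.1 hq
    simp only [Finset.mem_filter, Finset.mem_univ, true_and] at hv
    simp [hv]

theorem card_fiber_kernelBlocks {n m : ℕ} {P : Finset (Finset (Fin n))}
    (hP : IsBlockPartition P) :
    Nat.card {f : Fin n → Fin m // kernelBlocks f = P} = m.descFactorial P.card := by
  choose pt hpt huniq using hP.2
  have hpt_eq : ∀ v p, p ∈ P → v ∈ p → p = pt v := fun v p hp hv => huniq v p ⟨hp, hv⟩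
  have hker : ∀ e : P ↪ Fin m, kernelBlocks (fun v => e ⟨pt v, (hpt v).1⟩) = P := by
    intro e
    have hfib : ∀ v, (Finset.univ.filter fun w =>
        e ⟨pt w, (hpt w).1⟩ = e ⟨pt v, (hpt v).1⟩) = pt v := by
      intro v
      ext w
      simp only [Finset.mem_filter, Finset.mem_univ, true_and, e.injective.eq_iff,
        Subtype.mk.injEq]
      exact ⟨fun h => h ▸ (hpt w).2, fun h => (hpt_eq w _ (hpt v).1 h).symm⟩
    ext p
    simp only [kernelBlocks, Finset.mem_image, Finset.mem_univ, true_and, hfib]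
    constructor
    · rintro ⟨v, rfl⟩
      exact (hpt v).1
    · intro hp
      obtain ⟨v, hv⟩ := hP.1 p hp
      exact ⟨v, (hpt_eq v p hp hv).symm⟩
  have hbij : Function.Bijective
      (fun e : P ↪ Fin m =>
        (⟨_, hker e⟩ : {f : Fin n → Fin m // kernelBlocks f = P})) := by
    constructor
    · intro e e' h
      ext ⟨p, hp⟩
      obtain ⟨v, hv⟩ := hP.1 p hp
      have := congrFun (congrArg Subtype.val h) v
      simp only [← hpt_eq v p hp hv] at this
      rw [this]
    · rintro ⟨f, hf⟩
      have hfib : ∀ v w, pt w = pt v ↔ f w = f v := by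
        intro v w
        have hmem : (Finset.univ.filter fun u => f u = f v) ∈ P := by
          rw [← hf]
          exact Finset.mem_image_of_mem _ (Finset.mem_univ v)
        have hv := hpt_eq v _ hmem (by simp)
        constructor
        · intro h
          have := (hpt w).2
          rw [h, ← hv] at this
          simpa using this
        · intro h
          rw [← hv]
          exact (hpt_eq w _ hmem (by simp [h])).symm
      choose rep hrep using hP.1
      have hrep_pt : ∀ p (hp : p ∈ P), pt (rep p hp) = p :=
        fun p hp => (hpt_eq _ p hp (hrep p hp)).symm
      refine ⟨⟨fun p => f (rep p.1 p.2), ?_⟩, ?_⟩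
      · rintro ⟨p, hp⟩ ⟨q, hq⟩ h
        have := (hfib _ _).2 h
        rw [hrep_pt, hrep_pt] at this
        exact Subtype.ext this
      · ext v : 2
        exact (hfib _ _).1 (hrep_pt _ _)
  rw [← Nat.card_congr (Equiv.ofBijective _ hbij), Nat.card_eq_fintype_card,
    Fintype.card_embedding_eq]
  simp

theorem stirlingS2'_eq_card (n k : ℕ) [DecidablePred (IsBlockPartition (n := n))] :
    stirlingS2' n k =
      ((Finset.univ.filter fun P : Finset (Finset (Fin n)) => IsBlockPartition P).filter
        fun P => P.card = k).card := by
  classical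
  rw [stirlingS2', Nat.card_eq_fintype_card, Fintype.card_subtype]
  congr 1
  ext P
  simp [IsBlockPartition, and_comm]

theorem stirlingS2'_eq_zero_of_lt {n k : ℕ} (h : n < k) : stirlingS2' n k = 0 := by
  classical
  rw [stirlingS2'_eq_card, Finset.card_eq_zero, Finset.filter_eq_empty_iff]
  intro P hP
  obtain ⟨hne, huniq⟩ := (Finset.mem_filter.1 hP).2
  choose rep hrep using hne
  have hinj : Function.Injective fun p : P => rep p.1 p.2 := by
    rintro ⟨p, hp⟩ ⟨q, hq⟩ h
    refine Subtype.ext ((huniq (rep p hp)).unique ⟨hp, hrep p hp⟩ ⟨hq, ?_⟩)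
    have h' : rep p hp = rep q hq := h
    rw [h']
    exact hrep q hq
  have := Fintype.card_le_of_injective _ hinj
  simp only [Fintype.card_coe, Fintype.card_fin] at this
  omega

theorem pow_eq_sum_stirlingS2'_mul_descFactorial (m n : ℕ) :
    m ^ n = ∑ k ∈ Finset.range (n + 1), stirlingS2' n k * m.descFactorial k := by
  classical
  set U := Finset.univ.filter fun P : Finset (Finset (Fin n)) => IsBlockPartition P with hU
  have hfun : m ^ n = ∑ P ∈ U, m.descFactorial P.card := by
    have h := Finset.card_eq_sum_card_fiberwise (s := (Finset.univ : Finset (Fin n → Fin m)))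
      (t := U) (f := kernelBlocks)
      (fun f _ => Finset.mem_coe.2 (by simp [hU, isBlockPartition_kernelBlocks f]))
    rw [Finset.card_univ, Fintype.card_fun, Fintype.card_fin, Fintype.card_fin] at h
    rw [h]
    refine Finset.sum_congr rfl fun P hP => ?_
    rw [← card_fiber_kernelBlocks (Finset.mem_filter.1 hP).2, Nat.card_eq_fintype_card,
      Fintype.card_subtype]
  have hmaps : ∀ P ∈ U, P.card ∈ Finset.range (n + 1) := by
    intro P hP
    rw [Finset.mem_range]
    by_contra hlt
    have h0 := stirlingS2'_eq_zero_of_lt (n := n) (k := P.card) (by omega)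
    rw [stirlingS2'_eq_card, Finset.card_eq_zero] at h0
    exact Finset.notMem_empty P (h0 ▸ Finset.mem_filter.2 ⟨hP, rfl⟩)
  rw [hfun, ← Finset.sum_fiberwise_of_maps_to hmaps]
  refine Finset.sum_congr rfl fun k _ => ?_
  rw [stirlingS2'_eq_card, Finset.sum_congr rfl (g := fun _ => m.descFactorial k)
    fun P hP => by rw [(Finset.mem_filter.1 hP).2], Finset.sum_const, smul_eq_mul]

theorem pow_eq_sum_stirlingSecond_mul_descFactorial (m n : ℕ) :
    m ^ n = ∑ k ∈ Finset.range (n + 1), Nat.stirlingSecond n k * m.descFactorial k := by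
  induction n with
  | zero => simp
  | succ n ih =>
    have hstep : ∀ k, m * m.descFactorial k = k * m.descFactorial k + m.descFactorial (k + 1) := by
      intro k
      rw [Nat.descFactorial_succ, ← add_mul]
      rcases le_or_gt k m with h | h
      · rw [Nat.add_sub_cancel' h]
      · simp [Nat.descFactorial_of_lt h]
    rw [Finset.sum_range_succ', Nat.stirlingSecond_succ_zero, zero_mul, add_zero]
    have hsucc : ∀ k, Nat.stirlingSecond (n + 1) (k + 1) * m.descFactorial (k + 1) =
        (k + 1) * Nat.stirlingSecond n (k + 1) * m.descFactorial (k + 1) +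
          Nat.stirlingSecond n k * m.descFactorial (k + 1) := fun k => by
      rw [Nat.stirlingSecond_succ_succ, add_mul]
    simp only [hsucc, Finset.sum_add_distrib]
    have hshift : ∑ k ∈ Finset.range (n + 1),
        (k + 1) * Nat.stirlingSecond n (k + 1) * m.descFactorial (k + 1) =
        ∑ k ∈ Finset.range (n + 1), k * Nat.stirlingSecond n k * m.descFactorial k := by
      have h := Finset.sum_range_succ'
        (fun k => k * Nat.stirlingSecond n k * m.descFactorial k) (n + 1)
      rw [Finset.sum_range_succ, Nat.stirlingSecond_eq_zero_of_lt (Nat.lt_succ_self n)] at h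
      simpa using h.symm
    rw [hshift, pow_succ', ih, Finset.mul_sum, ← Finset.sum_add_distrib]
    refine Finset.sum_congr rfl fun k _ => ?_
    rw [mul_left_comm, hstep]
    ring

theorem eq_of_sum_mul_descFactorial_eq {n : ℕ} {a b : ℕ → ℕ}
    (h : ∀ m : ℕ, ∑ k ∈ Finset.range (n + 1), a k * m.descFactorial k =
      ∑ k ∈ Finset.range (n + 1), b k * m.descFactorial k) :
    ∀ k ≤ n, a k = b k := by
  intro k
  induction k using Nat.strong_induction_on with
  | _ k ih =>
    intro hk
    have hmem : k ∈ Finset.range (n + 1) := Finset.mem_range.2 (by omega)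
    have hrest : ∑ j ∈ (Finset.range (n + 1)).erase k, a j * k.descFactorial j =
        ∑ j ∈ (Finset.range (n + 1)).erase k, b j * k.descFactorial j := by
      refine Finset.sum_congr rfl fun j hj => ?_
      rcases lt_or_gt_of_ne (Finset.ne_of_mem_erase hj) with hlt | hgt
      · rw [ih j hlt (by omega)]
      · simp [Nat.descFactorial_of_lt hgt]
    have := h k
    rw [← Finset.add_sum_erase _ _ hmem, ← Finset.add_sum_erase _ (fun j => b j * _) hmem,
      hrest, Nat.add_right_cancel_iff] at this
    exact Nat.eq_of_mul_eq_mul_right (by rw [Nat.descFactorial_self]; exact k.factorial_pos) this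

theorem stirlingS2'_eq_stirlingSecond (n k : ℕ) : stirlingS2' n k = Nat.stirlingSecond n k := by
  rcases le_or_gt k n with h | h
  · refine eq_of_sum_mul_descFactorial_eq (n := n) (fun m => ?_) k h
    rw [← pow_eq_sum_stirlingS2'_mul_descFactorial, pow_eq_sum_stirlingSecond_mul_descFactorial]
  · rw [stirlingS2'_eq_zero_of_lt h, Nat.stirlingSecond_eq_zero_of_lt h]

namespace Polynomial

theorem card_roots_toFinset_le_card_roots_add_derivative_sdiff_roots_succ {p : ℝ[X]}
    (hq : p + derivative p ≠ 0) :
    p.roots.toFinset.card ≤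
      ((p + derivative p).roots.toFinset \ p.roots.toFinset).card + 1 := by
  have hp : p ≠ 0 := by rintro rfl; simp at hq
  refine Finset.card_le_sdiff_of_interleaved fun x hx y hy hxy hxy' => ?_
  rw [Multiset.mem_toFinset, mem_roots hp, IsRoot] at hx hy
  have hderiv : ∀ z, HasDerivAt (fun z => Real.exp z * p.eval z)
      (Real.exp z * p.eval z + Real.exp z * (derivative p).eval z) z :=
    fun z => (Real.hasDerivAt_exp z).mul (p.hasDerivAt z)
  obtain ⟨z, hz1, hz2⟩ := exists_deriv_eq_zero (f := fun z => Real.exp z * p.eval z) hxy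
    (Real.continuous_exp.mul p.continuous).continuousOn (by simp [hx, hy])
  refine ⟨z, ?_, hz1⟩
  rw [(hderiv z).deriv, ← mul_add, mul_eq_zero] at hz2
  rw [Multiset.mem_toFinset, mem_roots hq, IsRoot, eval_add]
  exact hz2.resolve_left (Real.exp_ne_zero z)

theorem rootMultiplicity_sub_one_le_rootMultiplicity_add_derivative {p : ℝ[X]}
    (hq : p + derivative p ≠ 0) (x : ℝ) :
    p.rootMultiplicity x - 1 ≤ (p + derivative p).rootMultiplicity x := by
  have hdvd := pow_rootMultiplicity_dvd p x
  exact (le_rootMultiplicity_iff hq).2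
    (dvd_add ((pow_dvd_pow _ (Nat.sub_le _ 1)).trans hdvd)
      (pow_sub_one_dvd_derivative_of_pow_dvd hdvd))

/-- Rolle's theorem for `exp x * p x`, with roots counted with multiplicities. -/
theorem card_roots_le_card_roots_add_derivative {p : ℝ[X]} (hq : p + derivative p ≠ 0) :
    Multiset.card p.roots ≤ Multiset.card (p + derivative p).roots + 1 := by
  set q := p + derivative p with hqdef
  calc
    Multiset.card p.roots = ∑ x ∈ p.roots.toFinset, p.roots.count x :=
      (Multiset.toFinset_sum_count_eq _).symm
    _ = ∑ x ∈ p.roots.toFinset, (p.roots.count x - 1 + 1) :=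
      (Eq.symm <| Finset.sum_congr rfl fun _ hx => tsub_add_cancel_of_le <|
        Nat.succ_le_iff.2 <| Multiset.count_pos.2 <| Multiset.mem_toFinset.1 hx)
    _ = (∑ x ∈ p.roots.toFinset, (p.rootMultiplicity x - 1)) + p.roots.toFinset.card := by
      simp only [Finset.sum_add_distrib, Finset.card_eq_sum_ones, count_roots]
    _ ≤ (∑ x ∈ p.roots.toFinset, q.rootMultiplicity x) +
          ((q.roots.toFinset \ p.roots.toFinset).card + 1) :=
      (add_le_add
        (Finset.sum_le_sum fun _ _ =>
          rootMultiplicity_sub_one_le_rootMultiplicity_add_derivative hq _)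
        (card_roots_toFinset_le_card_roots_add_derivative_sdiff_roots_succ hq))
    _ ≤ (∑ x ∈ p.roots.toFinset, q.roots.count x) +
          ((∑ x ∈ q.roots.toFinset \ p.roots.toFinset, q.roots.count x) + 1) := by
      simp only [← count_roots, Finset.card_eq_sum_ones]
      gcongr with x hx
      rw [Nat.succ_le_iff, Multiset.count_pos, ← Multiset.mem_toFinset]
      exact (Finset.mem_sdiff.1 hx).1
    _ = Multiset.card q.roots + 1 := by
      rw [← add_assoc, ← Finset.sum_union Finset.disjoint_sdiff, Finset.union_sdiff_self_eq_union, ←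
        Multiset.toFinset_sum_count_eq, ← Finset.sum_subset Finset.subset_union_right]
      intro x _ hx₂
      simpa only [Multiset.mem_toFinset, Multiset.count_eq_zero] using hx₂

theorem splits_of_natDegree_le_card_roots_succ {p : ℝ[X]}
    (h : p.natDegree ≤ Multiset.card p.roots + 1) : p.Splits := by
  obtain ⟨q, hmul, hdeg, hroots⟩ := exists_prod_multiset_X_sub_C_mul p
  have hq := splits_iff_card_roots.1 (Splits.of_natDegree_le_one (f := q) (by omega))
  rw [hroots, Multiset.card_zero] at hq
  exact splits_iff_card_roots.2 (by omega)

theorem Splits.add_derivative {p : ℝ[X]} (hp : p.Splits) : (p + derivative p).Splits := by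
  rcases eq_or_ne (p + derivative p) 0 with hq | hq
  · rw [hq]; exact Splits.zero
  refine splits_of_natDegree_le_card_roots_succ ?_
  have h1 := card_roots_le_card_roots_add_derivative hq
  have h2 := splits_iff_card_roots.1 hp
  have h3 : (p + derivative p).natDegree ≤ p.natDegree :=
    (natDegree_add_le _ _).trans (max_le le_rfl
      ((natDegree_derivative_le p).trans (Nat.sub_le _ _)))
  omega

end Polynomial

open Polynomial in
/-- The Touchard polynomial `∑ S(n, k) X ^ k`. -/
noncomputable def touchardPoly : ℕ → ℝ[X]
  | 0 => 1
  | n + 1 => X * (touchardPoly n + derivative (touchardPoly n))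

theorem coeff_touchardPoly (n k : ℕ) :
    (touchardPoly n).coeff k = Nat.stirlingSecond n k := by
  induction n generalizing k with
  | zero =>
    cases k <;> simp [touchardPoly, Polynomial.coeff_one]
  | succ n ih =>
    cases k with
    | zero => simp [touchardPoly]
    | succ k =>
      simp only [touchardPoly, Polynomial.coeff_X_mul, Polynomial.coeff_add,
        Polynomial.coeff_derivative, ih, Nat.stirlingSecond_succ_succ]
      push_cast
      ring

theorem splits_touchardPoly (n : ℕ) : (touchardPoly n).Splits := by
  induction n with
  | zero => exact Polynomial.Splits.one
  | succ n ih => exact Polynomial.Splits.X.mul ih.add_derivative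

theorem natDegree_touchardPoly (n : ℕ) : (touchardPoly n).natDegree = n := by
  refine Polynomial.natDegree_eq_of_le_of_coeff_ne_zero
    (Polynomial.natDegree_le_iff_coeff_eq_zero.2 fun k hk => ?_) ?_
  · rw [coeff_touchardPoly, Nat.stirlingSecond_eq_zero_of_lt hk, Nat.cast_zero]
  · simp [coeff_touchardPoly, Nat.stirlingSecond_self]

theorem leadingCoeff_touchardPoly (n : ℕ) : (touchardPoly n).leadingCoeff = 1 := by
  rw [Polynomial.leadingCoeff, natDegree_touchardPoly, coeff_touchardPoly,
    Nat.stirlingSecond_self, Nat.cast_one]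

theorem touchardPoly_eq_sum (n : ℕ) :
    touchardPoly n = ∑ k ∈ Finset.range (n + 1),
      Polynomial.C (Nat.stirlingSecond n k : ℝ) * Polynomial.X ^ k := by
  rw [(touchardPoly n).as_sum_range_C_mul_X_pow, natDegree_touchardPoly]
  simp only [coeff_touchardPoly]

theorem pow_le_eval_touchardPoly (n : ℕ) {x : ℝ} (hx : 0 ≤ x) :
    x ^ n ≤ (touchardPoly n).eval x := by
  rw [touchardPoly_eq_sum, Polynomial.eval_finsetSum, Finset.sum_range_succ]
  simp only [Polynomial.eval_mul, Polynomial.eval_C, Polynomial.eval_pow, Polynomial.eval_X,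
    Nat.stirlingSecond_self, Nat.cast_one, one_mul]
  exact le_add_of_nonneg_left (Finset.sum_nonneg fun k _ => by positivity)

theorem nonpos_of_mem_roots_touchardPoly {n : ℕ} {x : ℝ} (hx : x ∈ (touchardPoly n).roots) :
    x ≤ 0 := by
  by_contra! h
  have h0 := (Polynomial.mem_roots'.1 hx).2
  have h1 := pow_le_eval_touchardPoly n h.le
  rw [h0] at h1
  exact (pow_pos h n).not_ge h1

theorem touchardPoly_eq_prod (n : ℕ) :
    touchardPoly n =
      ((touchardPoly n).roots.map fun r => Polynomial.X - Polynomial.C r).prod := by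
  have h := (splits_touchardPoly n).eq_prod_roots
  rwa [leadingCoeff_touchardPoly, map_one, one_mul] at h

theorem pow_add_mul_sub_le_pow {a y : ℝ} (ha : 0 ≤ a) (hy : 0 ≤ y) (m : ℕ) :
    a ^ (m + 1) + (m + 1) * a ^ m * (y - a) ≤ y ^ (m + 1) := by
  rcases ha.eq_or_lt with rfl | ha
  · rcases m with _ | m
    · simp
    · simp only [ne_eq, Nat.add_eq_zero_iff, one_ne_zero, and_false, not_false_eq_true, zero_pow,
        mul_zero, zero_mul, add_zero]
      positivity
  · have h := one_add_mul_le_pow (a := y / a - 1)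
      (by linarith [div_nonneg hy ha.le]) (m + 1)
    have h' := mul_le_mul_of_nonneg_left h (pow_nonneg ha.le (m + 1))
    rw [← mul_pow, show a * (1 + (y / a - 1)) = y by field_simp; ring] at h'
    refine le_trans (le_of_eq ?_) h'
    push_cast
    field_simp
    ring

theorem hasSum_descFactorial_div_factorial (j : ℕ) :
    HasSum (fun k : ℕ => (k.descFactorial j : ℝ) / k.factorial) (Real.exp 1) := by
  have hexp : HasSum (fun i : ℕ => (1 : ℝ) / i.factorial) (Real.exp 1) := by
    have h := NormedSpace.expSeries_div_hasSum_exp (1 : ℝ)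
    simpa [Real.exp_eq_exp_ℝ] using h
  rw [← hasSum_nat_add_iff' j, Finset.sum_eq_zero fun i hi => by
    rw [Nat.descFactorial_of_lt (Finset.mem_range.1 hi), Nat.cast_zero, zero_div], sub_zero]
  refine hexp.congr_fun fun i => ?_
  have h := Nat.factorial_mul_descFactorial (Nat.le_add_left j i)
  rw [Nat.add_sub_cancel] at h
  rw [← h]
  have h1 := i.factorial_ne_zero
  have h2 : (i + j).descFactorial j ≠ 0 := by
    rw [Ne, Nat.descFactorial_eq_zero_iff_lt]; omega
  push_cast
  field_simp

/-- The `n`-th Bell number, as the value at `1` of the Touchard polynomial. -/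
noncomputable def bellReal (n : ℕ) : ℝ := (touchardPoly n).eval 1

theorem bellReal_eq_sum (n : ℕ) :
    bellReal n = ∑ k ∈ Finset.range (n + 1), (Nat.stirlingSecond n k : ℝ) := by
  rw [bellReal, touchardPoly_eq_sum, Polynomial.eval_finsetSum]
  simp

theorem one_le_bellReal (n : ℕ) : 1 ≤ bellReal n := by
  simpa [bellReal] using pow_le_eval_touchardPoly n zero_le_one

/-- Dobiński's formula. -/
theorem hasSum_pow_div_factorial (n : ℕ) :
    HasSum (fun k : ℕ => (k : ℝ) ^ n / k.factorial) (bellReal n * Real.exp 1) := by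
  rw [bellReal_eq_sum, Finset.sum_mul]
  refine (hasSum_sum fun j _ =>
    (hasSum_descFactorial_div_factorial j).mul_left (Nat.stirlingSecond n j : ℝ)).congr_fun
      fun k => ?_
  have h := pow_eq_sum_stirlingSecond_mul_descFactorial k n
  rw [← Nat.cast_pow, h]
  push_cast
  rw [Finset.sum_div]
  exact Finset.sum_congr rfl fun j _ => mul_div_assoc _ _ _

theorem hasSum_succ_pow_div_factorial (n : ℕ) :
    HasSum (fun i : ℕ => ((i : ℝ) + 1) ^ (n + 1) / (i + 1).factorial)
      (bellReal (n + 1) * Real.exp 1) := by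
  have h := (hasSum_nat_add_iff' 1).2 (hasSum_pow_div_factorial (n + 1))
  simpa using h

theorem bellReal_le_ratio_pow (n : ℕ) :
    bellReal n ≤ (bellReal (n + 1) / bellReal n) ^ n := by
  have hB := one_le_bellReal n
  have hB' := one_le_bellReal (n + 1)
  have hB0 : 0 < bellReal n := by linarith
  set r := bellReal (n + 1) / bellReal n with hr
  have hr0 : 0 < r := by positivity
  have hBr : bellReal (n + 1) = r * bellReal n := by rw [hr]; field_simp
  have hle := hasSum_le (fun k : ℕ => ?_)
    ((((hasSum_pow_div_factorial n).mul_left ((n + 1) * r))).sub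
      ((hasSum_pow_div_factorial (n + 1)).mul_left (n : ℝ)))
    ((hasSum_pow_div_factorial 0).mul_left (r ^ (n + 1)))
  · have h1 : bellReal 0 = 1 := by simp [bellReal, touchardPoly]
    rw [h1, hBr] at hle
    have he := Real.exp_pos 1
    have h2 : r * bellReal n ≤ r * r ^ n := by
      rw [← pow_succ']
      refine le_of_mul_le_mul_right ?_ he
      linarith
    exact le_of_mul_le_mul_left h2 hr0
  · have h := pow_add_mul_sub_le_pow (a := (k : ℝ)) (y := r) k.cast_nonneg hr0.le n
    have hk : (0 : ℝ) < k.factorial := by exact_mod_cast k.factorial_pos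
    have h' := div_le_div_of_nonneg_right h hk.le
    refine le_trans (le_of_eq ?_) (h'.trans (le_of_eq ?_))
    · rw [pow_succ]; field_simp; ring
    · rw [pow_zero]; ring

theorem bellReal_succ_le_bellReal_add_two (n : ℕ) : bellReal (n + 1) ≤ bellReal (n + 2) := by
  refine le_of_mul_le_mul_right ?_ (Real.exp_pos 1)
  refine hasSum_le (fun i => ?_) (hasSum_succ_pow_div_factorial n)
    (hasSum_succ_pow_div_factorial (n + 1))
  have hi : (1 : ℝ) ≤ (i : ℝ) + 1 := by simp
  gcongr
  omega

theorem one_sub_pow_mul_bellReal_le (n : ℕ) :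
    (1 - bellReal (n + 1) / bellReal (n + 2)) ^ (n + 1) * bellReal (n + 2) ≤
      bellReal (n + 1) := by
  have hB := one_le_bellReal (n + 2)
  have hB0 : 0 < bellReal (n + 2) := by linarith
  set a := 1 - bellReal (n + 1) / bellReal (n + 2) with ha
  have ha0 : 0 ≤ a := by
    rw [ha, sub_nonneg, div_le_one hB0]
    exact bellReal_succ_le_bellReal_add_two n
  have haB : a * bellReal (n + 2) = bellReal (n + 2) - bellReal (n + 1) := by
    rw [ha]; field_simp
  have hw := hasSum_succ_pow_div_factorial (n + 1)
  have hle := hasSum_le (fun i : ℕ => ?_)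
    ((hw.mul_left (a ^ (n + 1))).add
      (((hw.sub (hasSum_succ_pow_div_factorial n)).sub (hw.mul_left a)).mul_left
        ((n + 1) * a ^ n)))
    (hasSum_pow_div_factorial (n + 1))
  · refine le_of_mul_le_mul_right ?_ (Real.exp_pos 1)
    have hz : bellReal (n + 1 + 1) * Real.exp 1 - bellReal (n + 1) * Real.exp 1 -
        a * (bellReal (n + 1 + 1) * Real.exp 1) = 0 := by
      have : a * (bellReal (n + 2) * Real.exp 1) =
        (bellReal (n + 2) - bellReal (n + 1)) * Real.exp 1 := by rw [← haB]; ring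
      rw [this]; ring
    rw [hz, mul_zero, add_zero] at hle
    rw [mul_assoc]
    exact hle
  · have hi : (0 : ℝ) < (i : ℝ) + 1 := by positivity
    have hfact : (0 : ℝ) < i.factorial := by exact_mod_cast i.factorial_pos
    have h := pow_add_mul_sub_le_pow (a := a) (y := (i : ℝ) / (i + 1)) ha0 (by positivity) n
    have h' := mul_le_mul_of_nonneg_left h
      (by positivity : (0 : ℝ) ≤ ((i : ℝ) + 1) ^ (n + 1 + 1) / (i + 1).factorial)
    refine le_trans (le_of_eq ?_) (h'.trans (le_of_eq ?_))
    · rw [Nat.factorial_succ]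
      push_cast
      field_simp
      ring
    · rw [Nat.factorial_succ, div_pow]
      push_cast
      field_simp
      ring

theorem ratio_sub_one_mul_log_le (n : ℕ) :
    (bellReal (n + 2) / bellReal (n + 1) - 1) *
      Real.log (bellReal (n + 2) / bellReal (n + 1)) ≤ n + 1 := by
  have hB := one_le_bellReal (n + 1)
  have hB0 : 0 < bellReal (n + 1) := by linarith
  have hmono := bellReal_succ_le_bellReal_add_two n
  have hmain := one_sub_pow_mul_bellReal_le n
  set r := bellReal (n + 2) / bellReal (n + 1) with hr
  have hr1 : 1 ≤ r := by rw [hr, one_le_div hB0]; exact hmono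
  have hr_inv : bellReal (n + 1) / bellReal (n + 2) = r⁻¹ := by rw [hr, inv_div]
  have hBr : bellReal (n + 2) = r * bellReal (n + 1) := by rw [hr]; field_simp
  rcases hr1.eq_or_lt with h1 | h1
  · rw [← h1, sub_self, zero_mul]
    positivity
  have hr0 : 0 < r := by linarith
  have hpos : 0 < 1 - r⁻¹ := sub_pos.2 (inv_lt_one_of_one_lt₀ h1)
  rw [hr_inv, hBr, ← mul_assoc] at hmain
  have hle : (1 - r⁻¹) ^ (n + 1) * r ≤ 1 :=
    le_of_mul_le_mul_right (by rwa [one_mul]) hB0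
  have hlog := Real.log_nonpos (by positivity) hle
  rw [Real.log_mul (by positivity) hr0.ne', Real.log_pow] at hlog
  have hlow := Real.one_sub_inv_le_log_of_pos hpos
  have hinv : (1 - r⁻¹)⁻¹ = 1 + 1 / (r - 1) := by
    have : r - 1 ≠ 0 := by linarith
    have : 1 - r⁻¹ ≠ 0 := hpos.ne'
    field_simp
    ring
  rw [hinv] at hlow
  have hn : (0 : ℝ) < ((n + 1 : ℕ) : ℝ) := by positivity
  have h2 : Real.log r ≤ ((n + 1 : ℕ) : ℝ) * (1 / (r - 1)) := by nlinarith
  have h3 := mul_le_mul_of_nonneg_left h2 (by linarith : 0 ≤ r - 1)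
  refine h3.trans (le_of_eq ?_)
  have : r - 1 ≠ 0 := by linarith
  push_cast
  field_simp

theorem eventually_mul_ratio_le (M : ℝ) :
    ∀ᶠ n : ℕ in Filter.atTop, M * (bellReal (n + 1) / bellReal n) ≤ n := by
  wlog hM : 0 < M generalizing M
  · filter_upwards [this 1 one_pos] with n hn
    have : 0 < bellReal (n + 1) / bellReal n :=
      div_pos (by linarith [one_le_bellReal (n + 1)]) (by linarith [one_le_bellReal n])
    nlinarith
  filter_upwards [Filter.eventually_ge_atTop 1,
    tendsto_natCast_atTop_atTop.eventually_ge_atTop (M * Real.exp (2 * M)),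
    tendsto_natCast_atTop_atTop.eventually_ge_atTop (M * 2)] with n hn1 hn2 hn3
  obtain ⟨m, rfl⟩ : ∃ m, n = m + 1 := ⟨n - 1, by omega⟩
  have h := ratio_sub_one_mul_log_le m
  set r := bellReal (m + 1 + 1) / bellReal (m + 1) with hr
  by_contra! hlt
  rcases le_or_gt r 2 with h2 | h2
  · nlinarith
  · have hlog : Real.log r ≤ 2 * M := by
      push_cast at hlt
      by_contra! hc
      have : (r - 1) * (2 * M) < (r - 1) * Real.log r :=
        mul_lt_mul_of_pos_left hc (by linarith)
      nlinarith
    have hexp : r ≤ Real.exp (2 * M) := by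
      rw [← Real.exp_log (show 0 < r by linarith)]
      exact Real.exp_le_exp.2 hlog
    nlinarith [mul_le_mul_of_nonneg_left hexp hM.le]

open Polynomial in
/-- The probability generating polynomial of a sum of independent Bernoulli variables with
success probabilities `p j`. -/
noncomputable def bernoulliSumPoly {ι : Type*} (s : Finset ι) (p : ι → ℝ) : ℝ[X] :=
  ∏ j ∈ s, (C (1 - p j) + C (p j) * X)

section BernoulliSum

open Polynomial

variable {ι : Type*} (s : Finset ι) (p : ι → ℝ)

theorem eval_one_bernoulliSumPoly : (bernoulliSumPoly s p).eval 1 = 1 := by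
  simp [bernoulliSumPoly, eval_prod]

theorem eval_one_derivatives_bernoulliSumPoly :
    (derivative (bernoulliSumPoly s p)).eval 1 = ∑ j ∈ s, p j ∧
      (derivative (derivative (bernoulliSumPoly s p))).eval 1 =
        (∑ j ∈ s, p j) ^ 2 - ∑ j ∈ s, p j ^ 2 := by
  classical
  induction s using Finset.induction_on with
  | empty => simp [bernoulliSumPoly]
  | insert a s ha ih =>
    have h1 := eval_one_bernoulliSumPoly s p
    have hQ : bernoulliSumPoly (insert a s) p =
        (C (1 - p a) + C (p a) * X) * bernoulliSumPoly s p := by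
      rw [bernoulliSumPoly, Finset.prod_insert ha, bernoulliSumPoly]
    rw [hQ, Finset.sum_insert ha, Finset.sum_insert ha]
    simp only [derivative_mul, derivative_add, derivative_C, derivative_X, eval_add, eval_mul,
      eval_C, eval_X, ih.1, ih.2, h1, zero_mul, zero_add, mul_one]
    constructor <;> ring

variable {s p}

theorem log_one_sub_add_mul_le {p c : ℝ} (hp : p ∈ Set.Icc (0 : ℝ) 1) (hc : 1 ≤ c) :
    Real.log (1 - p + p * c) ≤ p * Real.log c + 2 * (c - 1) * (p * (1 - p)) := by
  obtain ⟨h0, h1⟩ := hp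
  have hlogc : 0 ≤ Real.log c := Real.log_nonneg hc
  have hpos : 0 < 1 - p + p * c := by nlinarith
  rcases le_total p (1 / 2) with h | h
  · have := Real.log_le_sub_one_of_pos hpos
    have h2 : 0 ≤ p * (c - 1) := mul_nonneg h0 (by linarith)
    nlinarith [mul_nonneg h0 hlogc]
  · have h2 : Real.log (1 - p + p * c) ≤ Real.log c :=
      Real.log_le_log hpos (by nlinarith)
    have h3 := Real.log_le_sub_one_of_pos (show 0 < c by linarith)
    have h4 : (1 - p) * Real.log c ≤ (1 - p) * (c - 1) :=
      mul_le_mul_of_nonneg_left h3 (by linarith)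
    have h5 : 0 ≤ (1 - p) * (c - 1) := mul_nonneg (by linarith) (by linarith)
    nlinarith

theorem log_eval_bernoulliSumPoly_le (hp : ∀ j ∈ s, p j ∈ Set.Icc (0 : ℝ) 1) {c : ℝ}
    (hc : 1 ≤ c) :
    Real.log ((bernoulliSumPoly s p).eval c) ≤
      (∑ j ∈ s, p j) * Real.log c + 2 * (c - 1) * ∑ j ∈ s, p j * (1 - p j) := by
  have hpos : ∀ j ∈ s, 1 - p j + p j * c ≠ 0 := fun j hj => by
    have := hp j hj
    have : 0 < 1 - p j + p j * c := by nlinarith [this.1, this.2]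
    exact this.ne'
  simp only [bernoulliSumPoly, eval_prod, eval_add, eval_mul, eval_C, eval_X]
  rw [Real.log_prod hpos, Finset.sum_mul, Finset.mul_sum, ← Finset.sum_add_distrib]
  exact Finset.sum_le_sum fun j hj => log_one_sub_add_mul_le (hp j hj) hc

theorem norm_prod_sub_prod_le {a b : ι → ℂ} (ha : ∀ j ∈ s, ‖a j‖ ≤ 1)
    (hb : ∀ j ∈ s, ‖b j‖ ≤ 1) :
    ‖∏ j ∈ s, a j - ∏ j ∈ s, b j‖ ≤ ∑ j ∈ s, ‖a j - b j‖ := by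
  classical
  induction s using Finset.induction_on with
  | empty => simp
  | insert i s hi ih =>
    have ih := ih (fun j hj => ha j (Finset.mem_insert_of_mem hj))
      (fun j hj => hb j (Finset.mem_insert_of_mem hj))
    have hprod : ‖∏ j ∈ s, b j‖ ≤ 1 := by
      rw [norm_prod]
      exact Finset.prod_le_one (fun _ _ => norm_nonneg _)
        fun j hj => hb j (Finset.mem_insert_of_mem hj)
    rw [Finset.prod_insert hi, Finset.prod_insert hi, Finset.sum_insert hi,
      show a i * ∏ j ∈ s, a j - b i * ∏ j ∈ s, b j =
        (a i - b i) * ∏ j ∈ s, b j + a i * (∏ j ∈ s, a j - ∏ j ∈ s, b j) by ring]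
    refine (norm_add_le _ _).trans (add_le_add ?_ ?_)
    · rw [norm_mul]
      exact mul_le_of_le_one_right (norm_nonneg _) hprod
    · rw [norm_mul]
      exact (mul_le_of_le_one_left (norm_nonneg _) (ha i (Finset.mem_insert_self _ _))).trans ih

/-- The characteristic function of a centred Bernoulli variable. -/
noncomputable def centredBernoulliCharFun (p u : ℝ) : ℂ :=
  Complex.exp (-(p * u : ℝ) * Complex.I) * (1 - p + p * Complex.exp (u * Complex.I))

theorem centredBernoulliCharFun_eq (p u : ℝ) :
    centredBernoulliCharFun p u = (1 - p : ℝ) * Complex.exp ((-(p * u) : ℝ) * Complex.I) +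
      p * Complex.exp (((1 - p) * u : ℝ) * Complex.I) := by
  have h : Complex.exp (((1 - p) * u : ℝ) * Complex.I) =
      Complex.exp ((-(p * u) : ℝ) * Complex.I) * Complex.exp (u * Complex.I) := by
    rw [← Complex.exp_add]
    congr 1
    push_cast
    ring
  rw [h, centredBernoulliCharFun]
  push_cast
  ring

theorem norm_centredBernoulliCharFun_le_one {p : ℝ} (hp : p ∈ Set.Icc (0 : ℝ) 1) (u : ℝ) :
    ‖centredBernoulliCharFun p u‖ ≤ 1 := by
  rw [centredBernoulliCharFun_eq]
  refine (norm_add_le _ _).trans (le_of_eq ?_)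
  rw [norm_mul, norm_mul, Complex.norm_exp_ofReal_mul_I, Complex.norm_exp_ofReal_mul_I,
    Complex.norm_real, Complex.norm_real, Real.norm_of_nonneg (by linarith [hp.2]),
    Real.norm_of_nonneg hp.1]
  ring

theorem norm_exp_ofReal_mul_I_sub_le {u : ℝ} (hu : |u| ≤ 1) :
    ‖Complex.exp (u * Complex.I) - (1 + u * Complex.I - (u : ℂ) ^ 2 / 2)‖ ≤ |u| ^ 3 := by
  have hnorm : ‖(u : ℂ) * Complex.I‖ = |u| := by simp
  have h := Complex.exp_bound (x := u * Complex.I) (by rwa [hnorm]) (n := 3) (by norm_num)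
  rw [hnorm] at h
  have hsum : ∑ m ∈ Finset.range 3, ((u : ℂ) * Complex.I) ^ m / (m.factorial : ℂ) =
      1 + u * Complex.I - (u : ℂ) ^ 2 / 2 := by
    simp [Finset.sum_range_succ, mul_pow, Nat.factorial]
    ring
  rw [hsum] at h
  refine h.trans (mul_le_of_le_one_right (by positivity) ?_)
  norm_num [Nat.factorial]

theorem norm_centredBernoulliCharFun_sub_le {p u : ℝ} (hp : p ∈ Set.Icc (0 : ℝ) 1)
    (hu : |u| ≤ 1) :
    ‖centredBernoulliCharFun p u - Complex.exp (-(p * (1 - p) * u ^ 2 / 2 : ℝ))‖ ≤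
      3 * (p * (1 - p)) * |u| ^ 3 := by
  obtain ⟨h0, h1⟩ := hp
  have hq0 : 0 ≤ 1 - p := by linarith
  have hpq : 0 ≤ p * (1 - p) := mul_nonneg h0 hq0
  have hpq1 : p * (1 - p) ≤ 1 := by nlinarith
  have hu0 := abs_nonneg u
  have hA : |-(p * u)| = p * |u| := by rw [abs_neg, abs_mul, abs_of_nonneg h0]
  have hB : |(1 - p) * u| = (1 - p) * |u| := by rw [abs_mul, abs_of_nonneg hq0]
  have eA := norm_exp_ofReal_mul_I_sub_le (u := -(p * u)) (by rw [hA]; nlinarith)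
  have eB := norm_exp_ofReal_mul_I_sub_le (u := (1 - p) * u) (by rw [hB]; nlinarith)
  rw [hA] at eA
  rw [hB] at eB
  have hu2 : u ^ 2 = |u| ^ 2 := (sq_abs u).symm
  have hsmall : p * (1 - p) * u ^ 2 / 2 ≤ |u| ^ 2 / 2 := by
    rw [hu2]
    have := mul_le_mul_of_nonneg_right hpq1 (sq_nonneg |u|)
    linarith
  have hnonneg : 0 ≤ p * (1 - p) * u ^ 2 / 2 := by positivity
  have hnormC : ‖((-(p * (1 - p) * u ^ 2 / 2 : ℝ) : ℝ) : ℂ)‖ = p * (1 - p) * u ^ 2 / 2 := by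
    rw [Complex.norm_real, norm_neg, Real.norm_of_nonneg hnonneg]
  have eC := Complex.norm_exp_sub_one_sub_id_le
    (x := ((-(p * (1 - p) * u ^ 2 / 2 : ℝ) : ℝ) : ℂ)) (by rw [hnormC]; nlinarith)
  rw [hnormC] at eC
  set EA := Complex.exp ((-(p * u) : ℝ) * Complex.I)
  set EB := Complex.exp (((1 - p) * u : ℝ) * Complex.I)
  have hsplit : centredBernoulliCharFun p u - Complex.exp (-(p * (1 - p) * u ^ 2 / 2 : ℝ)) =
      (1 - p : ℝ) * (EA - (1 + (-(p * u) : ℝ) * Complex.I - ((-(p * u) : ℝ) : ℂ) ^ 2 / 2)) +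
      p * (EB - (1 + ((1 - p) * u : ℝ) * Complex.I - (((1 - p) * u : ℝ) : ℂ) ^ 2 / 2)) -
      (Complex.exp ((-(p * (1 - p) * u ^ 2 / 2 : ℝ) : ℝ)) - 1 -
        ((-(p * (1 - p) * u ^ 2 / 2 : ℝ) : ℝ) : ℂ)) := by
    have hE : centredBernoulliCharFun p u = (1 - p : ℝ) * EA + p * EB :=
      centredBernoulliCharFun_eq p u
    rw [hE]
    push_cast
    ring
  rw [hsplit]
  refine (norm_sub_le _ _).trans ((add_le_add ((norm_add_le _ _).trans (add_le_add
    (?_ : _ ≤ p * (1 - p) * |u| ^ 3) (?_ : _ ≤ p * (1 - p) * |u| ^ 3)))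
    (?_ : _ ≤ p * (1 - p) * |u| ^ 3)).trans (le_of_eq (by ring)))
  · rw [norm_mul, Complex.norm_real, Real.norm_of_nonneg hq0]
    refine (mul_le_mul_of_nonneg_left eA hq0).trans ?_
    have : p ^ 3 ≤ p := pow_le_of_le_one h0 h1 (by norm_num)
    rw [mul_pow]
    have := mul_le_mul_of_nonneg_right this (mul_nonneg hq0 (pow_nonneg hu0 3))
    linarith
  · rw [norm_mul, Complex.norm_real, Real.norm_of_nonneg h0]
    refine (mul_le_mul_of_nonneg_left eB h0).trans ?_
    have : (1 - p) ^ 3 ≤ 1 - p := pow_le_of_le_one hq0 (by linarith) (by norm_num)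
    rw [mul_pow]
    have := mul_le_mul_of_nonneg_right this (mul_nonneg h0 (pow_nonneg hu0 3))
    linarith
  · refine eC.trans ?_
    have h4 : |u| ^ 4 ≤ |u| ^ 3 := pow_le_pow_of_le_one hu0 hu (by norm_num)
    have h5 : (p * (1 - p)) ^ 2 ≤ p * (1 - p) := by nlinarith
    calc (p * (1 - p) * u ^ 2 / 2) ^ 2 = (p * (1 - p)) ^ 2 * |u| ^ 4 / 4 := by
          rw [hu2]; ring
      _ ≤ p * (1 - p) * |u| ^ 3 / 4 := by gcongr
      _ ≤ p * (1 - p) * |u| ^ 3 := by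
          linarith [mul_nonneg hpq (pow_nonneg hu0 3)]

theorem norm_aeval_bernoulliSumPoly_sub_le (hp : ∀ j ∈ s, p j ∈ Set.Icc (0 : ℝ) 1) {u : ℝ}
    (hu : |u| ≤ 1) :
    ‖Complex.exp (-((∑ j ∈ s, p j) * u : ℝ) * Complex.I) *
        aeval (Complex.exp (u * Complex.I)) (bernoulliSumPoly s p) -
      Complex.exp (-((∑ j ∈ s, p j * (1 - p j)) * u ^ 2 / 2 : ℝ))‖ ≤
      3 * (∑ j ∈ s, p j * (1 - p j)) * |u| ^ 3 := by
  have h1 : Complex.exp (-((∑ j ∈ s, p j) * u : ℝ) * Complex.I) *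
      aeval (Complex.exp (u * Complex.I)) (bernoulliSumPoly s p) =
      ∏ j ∈ s, centredBernoulliCharFun (p j) u := by
    simp only [centredBernoulliCharFun, Finset.prod_mul_distrib, ← Complex.exp_sum]
    congr 1
    · rw [← Finset.sum_mul, Finset.sum_neg_distrib, Finset.sum_mul]
      push_cast
      rfl
    · simp [bernoulliSumPoly, map_prod]
  have h2 : Complex.exp (-((∑ j ∈ s, p j * (1 - p j)) * u ^ 2 / 2 : ℝ)) =
      ∏ j ∈ s, Complex.exp (-(p j * (1 - p j) * u ^ 2 / 2 : ℝ)) := by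
    rw [← Complex.exp_sum, Finset.sum_neg_distrib, Finset.sum_mul, Finset.sum_div]
    push_cast
    rfl
  rw [h1, h2, Finset.mul_sum, Finset.sum_mul]
  refine (norm_prod_sub_prod_le (fun j hj => norm_centredBernoulliCharFun_le_one (hp j hj) u)
    fun j hj => ?_).trans
    (Finset.sum_le_sum fun j hj => norm_centredBernoulliCharFun_sub_le (hp j hj) hu)
  rw [← Complex.ofReal_neg, Complex.norm_exp_ofReal, Real.exp_le_one_iff, neg_nonpos]
  have := mul_nonneg (hp j hj).1 (sub_nonneg.2 (hp j hj).2)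
  positivity

end BernoulliSum

theorem exists_touchardPoly_eq_bernoulliSumPoly (n : ℕ) :
    ∃ (ι : Type) (s : Finset ι) (p : ι → ℝ), (∀ j ∈ s, p j ∈ Set.Icc (0 : ℝ) 1) ∧
      touchardPoly n = Polynomial.C (bellReal n) * bernoulliSumPoly s p := by
  classical
  set R := (touchardPoly n).roots with hR
  have hle : ∀ j : R, (j.1 : ℝ) ≤ 0 := fun j =>
    nonpos_of_mem_roots_touchardPoly (n := n) (by rw [← hR]; exact Multiset.coe_mem)
  have hprod : touchardPoly n =
      Polynomial.C (∏ j : R, (1 - j.1)) *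
        bernoulliSumPoly Finset.univ fun j : R => 1 / (1 - j.1) := by
    rw [bernoulliSumPoly, map_prod, ← Finset.prod_mul_distrib]
    conv_lhs => rw [touchardPoly_eq_prod, ← hR, ← Multiset.map_univ_coe R, Multiset.map_map]
    change ∏ j : R, (Polynomial.X - Polynomial.C j.1) = _
    refine Finset.prod_congr rfl fun j _ => ?_
    have hj : (1 : ℝ) - j.1 ≠ 0 := by linarith [hle j]
    rw [mul_add, ← mul_assoc, ← map_mul, ← map_mul, mul_sub, mul_one_div_cancel hj]
    simp only [Polynomial.C_sub, Polynomial.C_1, mul_one]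
    ring
  have hbell : bellReal n = ∏ j : R, (1 - j.1) := by
    rw [bellReal, hprod, Polynomial.eval_mul, eval_one_bernoulliSumPoly, Polynomial.eval_C,
      mul_one]
  refine ⟨R, Finset.univ, fun j => 1 / (1 - j.1), fun j _ => ?_, hbell ▸ hprod⟩
  have := hle j
  exact ⟨by apply div_nonneg <;> linarith, by rw [div_le_one] <;> linarith⟩

/-- The probability that a uniformly random partition of an `n`-set has `k` blocks. -/
noncomputable def blockProb (n k : ℕ) : ℝ := Nat.stirlingSecond n k / bellReal n

/-- The mean number of blocks of a uniformly random partition of an `n`-set. -/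
noncomputable def blockMean (n : ℕ) : ℝ := ∑ k ∈ Finset.range (n + 1), (k : ℝ) * blockProb n k

/-- The variance of the number of blocks of a uniformly random partition of an `n`-set. -/
noncomputable def blockVar (n : ℕ) : ℝ :=
  ∑ k ∈ Finset.range (n + 1), ((k : ℝ) - blockMean n) ^ 2 * blockProb n k

theorem bellReal_pos (n : ℕ) : 0 < bellReal n := one_pos.trans_le (one_le_bellReal n)

theorem blockProb_nonneg (n k : ℕ) : 0 ≤ blockProb n k :=
  div_nonneg (Nat.cast_nonneg _) (bellReal_pos n).le

theorem sum_blockProb (n : ℕ) : ∑ k ∈ Finset.range (n + 1), blockProb n k = 1 := by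
  simp only [blockProb]
  rw [← Finset.sum_div, ← bellReal_eq_sum, div_self (bellReal_pos n).ne']

theorem eq_sum_blockProb_of_touchardPoly_eq {n : ℕ} {Q : Polynomial ℝ}
    (hQ : touchardPoly n = Polynomial.C (bellReal n) * Q) :
    Q = ∑ k ∈ Finset.range (n + 1), Polynomial.C (blockProb n k) * Polynomial.X ^ k := by
  have hB : (Polynomial.C (bellReal n) : Polynomial ℝ) ≠ 0 :=
    Polynomial.C_ne_zero.2 (bellReal_pos n).ne'
  refine mul_left_cancel₀ hB ?_
  rw [← hQ, touchardPoly_eq_sum, Finset.mul_sum]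
  refine Finset.sum_congr rfl fun k _ => ?_
  rw [← mul_assoc, ← map_mul, blockProb, mul_div_cancel₀ _ (bellReal_pos n).ne']

theorem exists_bernoulliSum (n : ℕ) :
    ∃ (ι : Type) (s : Finset ι) (p : ι → ℝ), (∀ j ∈ s, p j ∈ Set.Icc (0 : ℝ) 1) ∧
      touchardPoly n = Polynomial.C (bellReal n) * bernoulliSumPoly s p ∧
      blockMean n = ∑ j ∈ s, p j ∧ blockVar n = ∑ j ∈ s, p j * (1 - p j) := by
  obtain ⟨ι, s, p, hp, hQ⟩ := exists_touchardPoly_eq_bernoulliSumPoly n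
  have hsum := eq_sum_blockProb_of_touchardPoly_eq hQ
  obtain ⟨h1, h2⟩ := eval_one_derivatives_bernoulliSumPoly s p
  rw [hsum] at h1 h2
  simp only [Polynomial.derivative_sum, Polynomial.derivative_C_mul_X_pow,
    Polynomial.eval_finsetSum, Polynomial.eval_mul, Polynomial.eval_C, Polynomial.eval_pow,
    Polynomial.eval_X, one_pow, mul_one] at h1 h2
  have hmean : blockMean n = ∑ j ∈ s, p j := by
    rw [← h1, blockMean]
    exact Finset.sum_congr rfl fun k _ => mul_comm _ _
  refine ⟨ι, s, p, hp, hQ, hmean, ?_⟩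
  have hterm : ∀ k : ℕ, ((k : ℝ) - blockMean n) ^ 2 * blockProb n k =
      blockProb n k * k * ((k - 1 : ℕ) : ℝ) + (1 - 2 * blockMean n) * (k * blockProb n k) +
        blockMean n ^ 2 * blockProb n k := by
    intro k
    rcases k with _ | k
    · simp
    · push_cast [Nat.add_sub_cancel]
      ring
  rw [blockVar, Finset.sum_congr rfl fun k _ => hterm k, Finset.sum_add_distrib,
    Finset.sum_add_distrib, h2, ← Finset.mul_sum, ← Finset.mul_sum, sum_blockProb, ← blockMean,
    hmean]
  simp only [mul_sub, mul_one, Finset.sum_sub_distrib, sq]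
  ring

theorem bellReal_succ_eq (n : ℕ) : bellReal (n + 1) = bellReal n * (1 + blockMean n) := by
  obtain ⟨ι, s, p, -, hQ, hmean, -⟩ := exists_bernoulliSum n
  have h1 := (eval_one_derivatives_bernoulliSumPoly s p).1
  have h2 : bellReal (n + 1) =
      (touchardPoly n).eval 1 + (Polynomial.derivative (touchardPoly n)).eval 1 := by
    rw [bellReal, touchardPoly]
    simp
  rw [h2, hQ, Polynomial.derivative_C_mul, Polynomial.eval_mul, Polynomial.eval_mul, h1,
    eval_one_bernoulliSumPoly, Polynomial.eval_C, hmean]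
  ring

theorem natCast_mul_log_le (n : ℕ) {c : ℝ} (hc : 1 ≤ c) :
    n * Real.log c ≤
      Real.log (bellReal n) + blockMean n * Real.log c + 2 * (c - 1) * blockVar n := by
  obtain ⟨ι, s, p, hp, hQ, hmean, hvar⟩ := exists_bernoulliSum n
  have hle := log_eval_bernoulliSumPoly_le hp hc
  have hc0 : 0 < c := by linarith
  have hpow := pow_le_eval_touchardPoly n hc0.le
  rw [hQ, Polynomial.eval_mul, Polynomial.eval_C] at hpow
  have hpos : 0 < (bernoulliSumPoly s p).eval c :=
    pos_of_mul_pos_right ((pow_pos hc0 n).trans_le hpow) (bellReal_pos n).le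
  have hlog := Real.log_le_log (pow_pos hc0 n) hpow
  rw [Real.log_pow, Real.log_mul (bellReal_pos n).ne' hpos.ne'] at hlog
  rw [hmean, hvar]
  linarith

theorem blockMean_nonneg (n : ℕ) : 0 ≤ blockMean n :=
  Finset.sum_nonneg fun k _ => mul_nonneg k.cast_nonneg (blockProb_nonneg n k)

theorem tendsto_blockVar_atTop : Filter.Tendsto blockVar Filter.atTop Filter.atTop := by
  refine Filter.tendsto_atTop.2 fun A => ?_
  filter_upwards [Filter.eventually_ge_atTop 1, eventually_mul_ratio_le 3,
    eventually_mul_ratio_le (2 * Real.exp 3 * A)] with n hn h3 hA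
  obtain ⟨m, rfl⟩ : ∃ m, n = m + 1 := ⟨n - 1, by omega⟩
  have hratio := ratio_sub_one_mul_log_le m
  have hpow := bellReal_le_ratio_pow (m + 1)
  have hB := bellReal_pos (m + 1)
  have hr : bellReal (m + 1 + 1) / bellReal (m + 1) = 1 + blockMean (m + 1) := by
    rw [bellReal_succ_eq, mul_div_cancel_left₀ _ hB.ne']
  have hmean := blockMean_nonneg (m + 1)
  rw [hr] at h3 hA hpow hratio
  set r := 1 + blockMean (m + 1) with hrdef
  have hr1 : 1 ≤ r := by linarith
  have hr0 : 0 < r := by linarith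
  have hexp : 1 ≤ Real.exp 3 := Real.one_le_exp (by norm_num)
  have hmain := natCast_mul_log_le (m + 1) (c := Real.exp 3 * r)
    (one_le_mul_of_one_le_of_one_le hexp hr1)
  have hlogB := Real.log_le_log hB hpow
  rw [Real.log_pow] at hlogB
  rw [Real.log_mul (Real.exp_ne_zero 3) hr0.ne', Real.log_exp] at hmain
  have hmr : blockMean (m + 1) = r - 1 := by rw [hrdef]; ring
  rw [hmr] at hmain
  have hvar : 0 ≤ blockVar (m + 1) :=
    Finset.sum_nonneg fun k _ => mul_nonneg (sq_nonneg _) (blockProb_nonneg _ k)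
  push_cast at hmain hlogB h3 hA
  have hlow : (m : ℝ) + 1 ≤ 2 * (Real.exp 3 * r) * blockVar (m + 1) := by nlinarith
  have hpos : 0 < 2 * (Real.exp 3 * r) := by positivity
  refine le_of_mul_le_mul_left ?_ hpos
  linarith

theorem norm_sum_blockProb_mul_exp_sub_le {n : ℕ} (hvar : 0 < blockVar n) {t : ℝ}
    (ht : |t| ≤ √(blockVar n)) :
    ‖∑ k ∈ Finset.range (n + 1), (blockProb n k : ℂ) *
        Complex.exp (t * (((k : ℝ) - blockMean n) / √(blockVar n) : ℝ) * Complex.I) -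
      Complex.exp (-(t ^ 2 / 2 : ℝ))‖ ≤ 3 * |t| ^ 3 / √(blockVar n) := by
  obtain ⟨ι, s, p, hp, hQ, hmean, hvareq⟩ := exists_bernoulliSum n
  set σ := √(blockVar n) with hσ
  have hσ0 : 0 < σ := Real.sqrt_pos.2 hvar
  have hσ2 : σ ^ 2 = blockVar n := Real.sq_sqrt hvar.le
  have habs : |t / σ| = |t| / σ := by rw [abs_div, abs_of_pos hσ0]
  have h := norm_aeval_bernoulliSumPoly_sub_le (u := t / σ) hp
    (by rw [habs, div_le_one hσ0]; exact ht)
  rw [← hmean, ← hvareq, ← hσ2, habs] at h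
  have e1 : σ ^ 2 * (t / σ) ^ 2 / 2 = t ^ 2 / 2 := by field_simp
  have e2 : 3 * σ ^ 2 * (|t| / σ) ^ 3 = 3 * |t| ^ 3 / σ := by field_simp
  have e3 : Complex.exp (-(blockMean n * (t / σ) : ℝ) * Complex.I) *
      Polynomial.aeval (Complex.exp ((t / σ : ℝ) * Complex.I)) (bernoulliSumPoly s p) =
      ∑ k ∈ Finset.range (n + 1), (blockProb n k : ℂ) *
        Complex.exp (t * (((k : ℝ) - blockMean n) / σ : ℝ) * Complex.I) := by
    rw [eq_sum_blockProb_of_touchardPoly_eq hQ, map_sum, Finset.mul_sum]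
    refine Finset.sum_congr rfl fun k _ => ?_
    rw [map_mul, map_pow, Polynomial.aeval_C, Polynomial.aeval_X, ← Complex.exp_nat_mul,
      mul_left_comm, ← Complex.exp_add]
    congr 2
    push_cast
    ring
  rw [e1, e2, e3] at h
  exact h

/-- The law of the standardized number of blocks of a uniformly random partition of an `n`-set. -/
noncomputable def blockLaw (n : ℕ) : MeasureTheory.Measure ℝ :=
  ∑ k ∈ Finset.range (n + 1), ENNReal.ofReal (blockProb n k) •
    MeasureTheory.Measure.dirac (((k : ℝ) - blockMean n) / √(blockVar n))

instance isProbabilityMeasure_blockLaw (n : ℕ) :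
    MeasureTheory.IsProbabilityMeasure (blockLaw n) := by
  constructor
  simp only [blockLaw, MeasureTheory.Measure.finsetSum_apply, MeasureTheory.Measure.smul_apply,
    MeasureTheory.measure_univ, smul_eq_mul, mul_one]
  rw [← ENNReal.ofReal_sum_of_nonneg fun k _ => blockProb_nonneg n k, sum_blockProb,
    ENNReal.ofReal_one]

theorem charFun_blockLaw (n : ℕ) (t : ℝ) :
    MeasureTheory.charFun (blockLaw n) t = ∑ k ∈ Finset.range (n + 1), (blockProb n k : ℂ) *
      Complex.exp (t * (((k : ℝ) - blockMean n) / √(blockVar n) : ℝ) * Complex.I) := by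
  rw [MeasureTheory.charFun_apply_real, blockLaw, MeasureTheory.integral_finsetSum_measure]
  · refine Finset.sum_congr rfl fun k _ => ?_
    rw [MeasureTheory.integral_smul_measure, MeasureTheory.integral_dirac,
      ENNReal.toReal_ofReal (blockProb_nonneg n k), Complex.real_smul]
  · exact fun k _ => (MeasureTheory.integrable_dirac (by simp)).smul_measure ENNReal.ofReal_ne_top

theorem blockLaw_real_Iic (n : ℕ) (x : ℝ) :
    (blockLaw n).real (Set.Iic x) = ∑ k ∈ Finset.range (n + 1),
      if ((k : ℝ) - blockMean n) / √(blockVar n) ≤ x then blockProb n k else 0 := by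
  rw [MeasureTheory.measureReal_def, blockLaw, MeasureTheory.Measure.finsetSum_apply,
    ENNReal.toReal_sum]
  · refine Finset.sum_congr rfl fun k _ => ?_
    rw [MeasureTheory.Measure.smul_apply, MeasureTheory.Measure.dirac_apply' _ measurableSet_Iic]
    by_cases h : ((k : ℝ) - blockMean n) / √(blockVar n) ≤ x
    · simp [h, blockProb_nonneg]
    · simp [h]
  · intro k _
    rw [MeasureTheory.Measure.smul_apply]
    exact ENNReal.mul_ne_top ENNReal.ofReal_ne_top (MeasureTheory.measure_ne_top _ _)

theorem tendsto_charFun_blockLaw (t : ℝ) :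
    Filter.Tendsto (fun n => MeasureTheory.charFun (blockLaw n) t) Filter.atTop
      (nhds (MeasureTheory.charFun (ProbabilityTheory.gaussianReal 0 1) t)) := by
  have hsqrt : Filter.Tendsto (fun n => √(blockVar n)) Filter.atTop Filter.atTop :=
    Real.tendsto_sqrt_atTop.comp tendsto_blockVar_atTop
  have hlim : MeasureTheory.charFun (ProbabilityTheory.gaussianReal 0 1) t =
      Complex.exp (-(t ^ 2 / 2 : ℝ)) := by
    rw [ProbabilityTheory.charFun_gaussianReal]
    congr 1
    push_cast
    ring
  rw [hlim, tendsto_iff_norm_sub_tendsto_zero]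
  refine squeeze_zero' (Filter.Eventually.of_forall fun n => norm_nonneg _) ?_
    (hsqrt.const_div_atTop (3 * |t| ^ 3))
  filter_upwards [tendsto_blockVar_atTop.eventually_gt_atTop 0,
    hsqrt.eventually_ge_atTop |t|] with n hvar ht
  rw [charFun_blockLaw]
  exact norm_sum_blockProb_mul_exp_sub_le hvar ht

theorem gaussianReal_real_Iic (x : ℝ) :
    (ProbabilityTheory.gaussianReal 0 1).real (Set.Iic x) = stdNormalCDF x := by
  rw [MeasureTheory.measureReal_def,
    ProbabilityTheory.gaussianReal_apply_eq_integral 0 one_ne_zero, ENNReal.toReal_ofReal,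
    MeasureTheory.integral_Iic_eq_integral_Iio, stdNormalCDF]
  · refine MeasureTheory.setIntegral_congr_fun measurableSet_Iio fun t _ => ?_
    simp [ProbabilityTheory.gaussianPDFReal, div_eq_inv_mul]
  · exact MeasureTheory.integral_nonneg fun t => ProbabilityTheory.gaussianPDFReal_nonneg _ _ _

theorem tendsto_blockLaw_real_Iic (x : ℝ) :
    Filter.Tendsto (fun n => (blockLaw n).real (Set.Iic x)) Filter.atTop
      (nhds (stdNormalCDF x)) := by
  let μ : ℕ → MeasureTheory.ProbabilityMeasure ℝ := fun n => ⟨blockLaw n, inferInstance⟩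
  let ν : MeasureTheory.ProbabilityMeasure ℝ := ⟨ProbabilityTheory.gaussianReal 0 1, inferInstance⟩
  have hweak : Filter.Tendsto μ Filter.atTop (nhds ν) :=
    MeasureTheory.ProbabilityMeasure.tendsto_of_tendsto_charFun tendsto_charFun_blockLaw
  have hnull : ProbabilityTheory.gaussianReal 0 1 (frontier (Set.Iic x)) = 0 := by
    have := ProbabilityTheory.nullSingletonClass_gaussianReal (μ := 0) (v := 1) one_ne_zero
    rw [frontier_Iic, MeasureTheory.measure_singleton]
  have h := MeasureTheory.ProbabilityMeasure.tendsto_measure_of_null_frontier_of_tendsto' hweak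
    hnull
  rw [← gaussianReal_real_Iic]
  exact (ENNReal.tendsto_toReal (MeasureTheory.measure_ne_top _ _)).comp h

theorem finsum_int_eq_sum_range {f : ℤ → ℝ} {n : ℕ} (hneg : ∀ k < 0, f k = 0)
    (hlt : ∀ k : ℕ, n < k → f k = 0) : ∑ᶠ k, f k = ∑ k ∈ Finset.range (n + 1), f k := by
  rw [finsum_eq_sum_of_support_subset (s := (Finset.range (n + 1)).map Nat.castEmbedding),
    Finset.sum_map]
  · rfl
  · intro k hk
    obtain ⟨m, rfl⟩ : ∃ m : ℕ, (m : ℤ) = k := by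
      refine ⟨k.toNat, Int.toNat_of_nonneg ?_⟩
      by_contra! h
      exact hk (hneg k h)
    have : m ≤ n := by
      by_contra! h
      exact hk (hlt m h)
    simpa using Nat.lt_succ_of_le this

/-- The Stirling numbers of the second kind `S(n, k)`, extended by zero to `k : ℤ`. -/
noncomputable def stirlingSeq (n : ℕ) (k : ℤ) : ℝ :=
  if 0 ≤ k then (stirlingS2' n k.toNat : ℝ) else 0

theorem stirlingSeq_natCast (n k : ℕ) : stirlingSeq n k = Nat.stirlingSecond n k := by
  simp [stirlingSeq, stirlingS2'_eq_stirlingSecond]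

theorem stirlingSeq_of_neg {n : ℕ} {k : ℤ} (hk : k < 0) : stirlingSeq n k = 0 :=
  if_neg hk.not_ge

theorem stirlingSeq_of_lt {n k : ℕ} (hk : n < k) : stirlingSeq n k = 0 := by
  rw [stirlingSeq_natCast, Nat.stirlingSecond_eq_zero_of_lt hk, Nat.cast_zero]

theorem seqTotal_stirlingSeq (n : ℕ) : seqTotal (stirlingSeq n) = bellReal n := by
  rw [seqTotal, finsum_int_eq_sum_range (fun _ => stirlingSeq_of_neg) fun _ => stirlingSeq_of_lt,
    bellReal_eq_sum]
  simp only [stirlingSeq_natCast]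

theorem seqPMF_stirlingSeq_natCast (n k : ℕ) : seqPMF (stirlingSeq n) k = blockProb n k := by
  rw [seqPMF, seqTotal_stirlingSeq, stirlingSeq_natCast, blockProb]

theorem seqPMF_stirlingSeq_of_neg {n : ℕ} {k : ℤ} (hk : k < 0) : seqPMF (stirlingSeq n) k = 0 := by
  rw [seqPMF, stirlingSeq_of_neg hk, zero_div]

theorem seqPMF_stirlingSeq_of_lt {n k : ℕ} (hk : n < k) : seqPMF (stirlingSeq n) k = 0 := by
  rw [seqPMF, stirlingSeq_of_lt hk, zero_div]

theorem finsum_mul_seqPMF_stirlingSeq (n : ℕ) (f : ℤ → ℝ) :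
    ∑ᶠ k, f k * seqPMF (stirlingSeq n) k = ∑ k ∈ Finset.range (n + 1), f k * blockProb n k := by
  rw [finsum_int_eq_sum_range (n := n)]
  · simp only [seqPMF_stirlingSeq_natCast]
  · exact fun k hk => by rw [seqPMF_stirlingSeq_of_neg hk, mul_zero]
  · exact fun k hk => by rw [seqPMF_stirlingSeq_of_lt hk, mul_zero]

theorem seqMean_stirlingSeq (n : ℕ) : seqMean (stirlingSeq n) = blockMean n := by
  rw [seqMean, finsum_mul_seqPMF_stirlingSeq n fun k => (k : ℝ), blockMean]
  simp only [Int.cast_natCast]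

theorem seqStdDev_stirlingSeq (n : ℕ) : seqStdDev (stirlingSeq n) = √(blockVar n) := by
  rw [seqStdDev, seqMean_stirlingSeq,
    finsum_mul_seqPMF_stirlingSeq n fun k => ((k : ℝ) - blockMean n) ^ 2, blockVar]
  simp only [Int.cast_natCast]

theorem seqNormalizedCDF_stirlingSeq (n : ℕ) (x : ℝ) :
    seqNormalizedCDF (stirlingSeq n) x = (blockLaw n).real (Set.Iic x) := by
  classical
  have hind : ∀ k : ℤ,
      ∑ᶠ _ : k ∈ {k : ℤ | ((k : ℝ) - blockMean n) / √(blockVar n) ≤ x}, seqPMF (stirlingSeq n) k =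
        (if ((k : ℝ) - blockMean n) / √(blockVar n) ≤ x then 1 else 0) *
          seqPMF (stirlingSeq n) k := by
    intro k
    rw [finsum_eq_if, ite_mul, one_mul, zero_mul]
    rfl
  rw [seqNormalizedCDF, seqMean_stirlingSeq, seqStdDev_stirlingSeq, finsum_congr hind,
    finsum_mul_seqPMF_stirlingSeq n fun k =>
      if ((k : ℝ) - blockMean n) / √(blockVar n) ≤ x then 1 else 0, blockLaw_real_Iic]
  simp only [Int.cast_natCast, ite_mul, one_mul, zero_mul]

/-- Harper's theorem: the sequence of Stirling numbers of the second kind is asymptotically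
normal. -/
theorem stirling_asymptotically_normal :
    AsymptoticallyNormal (fun n k => if 0 ≤ k then (stirlingS2' n k.toNat : ℝ) else 0) := by
  intro x
  change Filter.Tendsto (fun n => seqNormalizedCDF (stirlingSeq n) x) _ _
  simp only [seqNormalizedCDF_stirlingSeq]
  exact tendsto_blockLaw_real_Iic x
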